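/- Let p be a prime with p ≡ 7 (mod 8), and suppose there exists a Hadamard matrix of order (p+1)/2. Then there exist N = p(p+1)/2 unitary matrices U_1, ..., U_N ∈ M_p(ℂ) such that tr(U_i* U_j) = 0 for all i ≠ j, the U_i span the symmetric subspace S_p of M_p(ℂ), and there is no unitary matrix V ∈ M_p(ℂ) with tr(U_i* V) = 0 for all i. (Under the Choi–Jamiolkowski isomorphism, the rescaled U_i/√p form a UMEB of cardinality p(p+1)/2 in ℂ^p ⊗ ℂ^p.) -/

import Mathlib

open Matrix

/-- The symmetric subspace `S_d` of `M_d(ℂ)`: matrices `A` with `Aᵀ = A`. -/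
noncomputable def symMatrices (d : ℕ) : Submodule ℂ (Matrix (Fin d) (Fin d) ℂ) where
  carrier := {A : Matrix (Fin d) (Fin d) ℂ | Aᵀ = A}
  add_mem' := by
    intro a b ha hb
    simp only [Set.mem_setOf_eq, Matrix.transpose_add] at *
    rw [ha, hb]
  zero_mem' := by simp
  smul_mem' := by
    intro c A hA
    simp only [Set.mem_setOf_eq, Matrix.transpose_smul] at *
    rw [hA]

/-- For `s` in an abelian group, the matrix with `f (x - s)` at `(x, x)` plus `A (x - s)` at
`(x, 2s - x)`. -/
def shiftedReflection {F : Type*} [DecidableEq F] [AddCommGroup F] (f A : F → ℝ) (s : F) :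
    Matrix F F ℝ :=
  of fun x y => (if y = x then f (x - s) else 0) + (if y = s + s - x then A (x - s) else 0)

section ShiftedReflection

variable {F : Type*} [DecidableEq F] [AddCommGroup F] {f A : F → ℝ}

theorem shiftedReflection_transpose (hA : ∀ x, A (-x) = A x) (s : F) :
    (shiftedReflection f A s)ᵀ = shiftedReflection f A s := by
  ext x y
  simp only [shiftedReflection, transpose_apply, of_apply]
  congr 1
  · by_cases h : x = y
    · simp [h]
    · simp [h, Ne.symm h]
  · by_cases h : x = s + s - y
    · have h' : y = s + s - x := by rw [h]; abel
      rw [if_pos h, if_pos h', ← hA, h']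
      congr 1; abel
    · have h' : y ≠ s + s - x := fun h' => h (by rw [h']; abel)
      rw [if_neg h, if_neg h']

variable [Fintype F]

theorem shiftedReflection_mul_apply (s : F) (N : Matrix F F ℝ) (x y : F) :
    (shiftedReflection f A s * N) x y = f (x - s) * N x y + A (x - s) * N (s + s - x) y := by
  simp [shiftedReflection, mul_apply, add_mul, Finset.sum_add_distrib]

theorem shiftedReflection_mul_self (hf : ∀ x, f (-x) = -f x) (hA : ∀ x, A (-x) = A x)
    (hfA : ∀ x, f x ^ 2 + A x ^ 2 = 1) (s : F) :
    shiftedReflection f A s * shiftedReflection f A s = 1 := by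
  ext x y
  have hneg : s + s - x - s = -(x - s) := by abel
  have hinv : s + s - (s + s - x) = x := by abel
  rw [shiftedReflection_mul_apply]
  simp only [shiftedReflection, of_apply, hneg, hinv, hf, hA, one_apply, eq_comm (a := x)]
  have := hfA (x - s)
  split_ifs <;> linarith

theorem trace_shiftedReflection_mul {B : F → ℝ} (hB : ∀ x, B (-x) = B x)
    (h2 : ∀ x y : F, x + x = y + y → x = y) (s t : F) :
    trace (shiftedReflection f A s * shiftedReflection f B t) =
      ∑ x, f (x - s) * f (x - t) + f (t - s) * B 0 + f (s - t) * A 0 +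
        if s = t then ∑ x, A x * B x else 0 := by
  have hdiag : ∀ u x : F, x = u + u - x ↔ x = u := fun u x =>
    ⟨fun h => h2 _ _ (by nth_rewrite 1 [h]; abel), fun h => by rw [h]; abel⟩
  have hanti : ∀ x : F, x = t + t - (s + s - x) ↔ s = t := fun x =>
    ⟨fun h => h2 _ _ (by rw [← sub_eq_zero] at h ⊢; rw [← h]; abel), fun h => by rw [h]; abel⟩
  have hsum : ∑ x, (if s = t then A (x - s) * B (s + s - x - t) else 0) =
      if s = t then ∑ x, A x * B x else 0 := by
    split_ifs with h
    · subst h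
      rw [← Equiv.sum_comp (Equiv.subRight s) fun x => A x * B x]
      refine Finset.sum_congr rfl fun x _ => ?_
      rw [Equiv.subRight_apply, ← hB (x - s)]
      congr 2; abel
    · simp
  simp only [trace, diag_apply, shiftedReflection_mul_apply]
  simp only [shiftedReflection, of_apply, hdiag, hanti, if_true, mul_add, mul_ite, mul_zero,
    Finset.sum_add_distrib, hsum, Finset.sum_ite_eq', Finset.mem_univ, sub_self,
    add_sub_cancel_right]
  ring

end ShiftedReflection

theorem sum_quadraticChar_mul_add {F : Type*} [Field F] [Fintype F] [DecidableEq F]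
    (hF : ringChar F ≠ 2) {d : F} (hd : d ≠ 0) :
    ∑ u, quadraticChar F u * quadraticChar F (u + d) = -1 := by
  have hinv : (quadraticChar F)⁻¹ = quadraticChar F := quadraticChar_isQuadratic F |>.inv
  have hJ := jacobiSum_nontrivial_inv (quadraticChar_ne_one hF)
  have hneg : quadraticChar F (-1) ^ 2 = 1 := quadraticChar_sq_one (neg_ne_zero.2 one_ne_zero)
  have hd2 : quadraticChar F d ^ 2 = 1 := quadraticChar_sq_one hd
  rw [hinv, jacobiSum] at hJ
  rw [← Equiv.sum_comp (Equiv.mulLeft₀ (-d) (neg_ne_zero.2 hd))]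
  calc _ = ∑ v, quadraticChar F (-1) * (quadraticChar F v * quadraticChar F (1 - v)) := by
        refine Finset.sum_congr rfl fun v _ => ?_
        simp only [Equiv.mulLeft₀_apply]
        rw [show -d * v + d = d * (1 - v) by ring,
          show -d * v = -1 * (d * v) by ring]
        simp only [map_mul]
        linear_combination quadraticChar F (-1) * quadraticChar F v * quadraticChar F (1 - v) * hd2
    _ = -1 := by
        rw [← Finset.mul_sum, hJ]
        linear_combination -hneg

/-- The class of `u` modulo `±1`, as the distance to zero in `ZMod p`. -/
def foldLabel {p n : ℕ} [NeZero p] (h : p / 2 < n) (u : ZMod p) : Fin n :=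
  ⟨u.valMinAbs.natAbs, u.natAbs_valMinAbs_le.trans_lt h⟩

theorem foldLabel_neg {p n : ℕ} [NeZero p] (h : p / 2 < n) (u : ZMod p) :
    foldLabel h (-u) = foldLabel h u := by
  simp [foldLabel]

theorem foldLabel_zero {p n : ℕ} [NeZero p] [NeZero n] (h : p / 2 < n) :
    foldLabel h (0 : ZMod p) = 0 := by
  ext; simp [foldLabel]

theorem sum_foldLabel {p n : ℕ} [NeZero p] [NeZero n] (hpn : p + 1 = 2 * n) (h : p / 2 < n)
    (g : Fin n → ℝ) : ∑ u : ZMod p, g (foldLabel h u) = 2 * ∑ j, g j - g 0 := by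
  have hcard : ∀ j : Fin n, (Finset.univ.filter fun u : ZMod p => foldLabel h u = j).card =
      if j = 0 then 1 else 2 := by
    intro j
    have hj : ((j : ℕ) : ZMod p).valMinAbs.natAbs = j := by
      have := j.2
      rw [ZMod.valMinAbs_natCast_of_le_half (by omega), Int.natAbs_natCast]
    have hfib : (Finset.univ.filter fun u : ZMod p => foldLabel h u = j) =
        {((j : ℕ) : ZMod p), -((j : ℕ) : ZMod p)} := by
      ext u
      simp only [Finset.mem_filter, Finset.mem_univ, true_and, Finset.mem_insert,
        Finset.mem_singleton, ← ZMod.natAbs_valMinAbs_eq_natAbs_valMinAbs, hj, foldLabel,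
        Fin.ext_iff]
    rw [hfib]
    split_ifs with h0
    · simp [h0]
    · refine Finset.card_pair fun he => h0 ?_
      have h0' : ((2 * (j : ℕ) : ℕ) : ZMod p) = 0 := by
        push_cast; linear_combination he
      rw [ZMod.natCast_eq_zero_iff] at h0'
      have hle := Nat.le_of_dvd (by have := Fin.val_ne_zero_iff.2 h0; omega) h0'
      omega
  rw [← Finset.sum_fiberwise Finset.univ (foldLabel h)]
  calc _ = ∑ j : Fin n, (if j = 0 then (1 : ℝ) else 2) * g j := by
        refine Finset.sum_congr rfl fun j _ => ?_
        rw [Finset.sum_congr rfl fun u hu => by rw [(Finset.mem_filter.1 hu).2],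
          Finset.sum_const, hcard, nsmul_eq_mul]
        split_ifs <;> simp
    _ = ∑ j : Fin n, (2 * g j - if j = 0 then g j else 0) := by
        refine Finset.sum_congr rfl fun j _ => ?_
        split_ifs <;> ring
    _ = _ := by simp [Finset.sum_sub_distrib, Finset.mul_sum]

/-- A Hadamard matrix of order `(p + 1) / 2` with `p ≡ 3 (mod 4)` prime gives `p (p + 1) / 2`
symmetric real involutions of order `p` forming a regular simplex. -/
theorem exists_simplex_of_symmetric_involutions {p n : ℕ} [Fact p.Prime] (hp4 : p % 4 = 3)
    (hpn : p + 1 = 2 * n) {H : Matrix (Fin n) (Fin n) ℝ} (hH1 : ∀ i j, H i j = 1 ∨ H i j = -1)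
    (hH : Hᵀ * H = (n : ℝ) • 1) :
    ∃ M : Fin n × ZMod p → Matrix (ZMod p) (ZMod p) ℝ,
      (∀ i, (M i)ᵀ = M i) ∧ (∀ i, M i * M i = 1) ∧ (∀ i j, trace (M i) = trace (M j)) ∧
      ∀ i j, i ≠ j → trace (M i * M j) = -1 / (p + 2) := by
  have : NeZero n := ⟨by omega⟩
  have hlab : p / 2 < n := by omega
  have hchar : ringChar (ZMod p) ≠ 2 := by rw [ZMod.ringChar_zmod_n]; omega
  have h2 : ∀ x y : ZMod p, x + x = y + y → x = y := fun x y hxy =>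
    mul_left_cancel₀ (Ring.two_ne_zero hchar) (by linear_combination hxy)
  have hHsq : ∀ i j, H i j ^ 2 = 1 := fun i j => by rcases hH1 i j with h | h <;> simp [h]
  set χ : ZMod p → ℝ := fun u => (quadraticChar (ZMod p) u : ℝ) with hχ
  have hχneg : ∀ x, χ (-x) = -χ x := by
    intro x
    have : quadraticChar (ZMod p) (-1) = -1 := by
      rw [quadraticChar_neg_one_iff_not_isSquare, ZMod.exists_sq_eq_neg_one_iff]; simp [hp4]
    simp only [hχ]
    rw [← neg_one_mul x, map_mul, this]
    push_cast; ring
  have hχ0 : χ 0 = 0 := by simp [hχ]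
  have hχsq : ∀ x, x ≠ 0 → χ x ^ 2 = 1 := fun x hx => by
    have := quadraticChar_sq_one hx
    simp only [hχ]; exact_mod_cast this
  have hχcorr : ∀ d, d ≠ 0 → ∑ x, χ x * χ (x + d) = -1 := fun d hd => by
    have := sum_quadraticChar_mul_add hchar hd
    simp only [hχ]; exact_mod_cast this
  have hχnorm : ∑ x, χ x * χ x = p - 1 := by
    have : ∀ x, χ x * χ x = 1 - if x = 0 then 1 else 0 := fun x => by
      split_ifs with h
      · simp [h, hχ0]
      · rw [← sq, hχsq x h]; ring
    simp [this]
  obtain ⟨c, hc⟩ : ∃ c : ℝ, c ^ 2 = 1 / (p + 2) := ⟨√(1 / (p + 2)), Real.sq_sqrt (by positivity)⟩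
  obtain ⟨b, hb⟩ : ∃ b : ℝ, b ^ 2 = (p + 1) / (p + 2) :=
    ⟨√((p + 1) / (p + 2)), Real.sq_sqrt (by positivity)⟩
  set h : Fin n → Fin n → ℝ := fun k j => H 0 k * H j k with hh
  have hhsq : ∀ k j, h k j ^ 2 = 1 := fun k j => by simp [hh, mul_pow, hHsq]
  have hh0 : ∀ k, h k 0 = 1 := fun k => by simp [hh, ← sq, hHsq]
  have hhorth : ∀ k l, k ≠ l → ∑ j, h k j * h l j = 0 := fun k l hkl => by
    have := congrFun (congrFun hH k) l
    simp only [mul_apply, transpose_apply, Matrix.smul_apply, one_apply_ne hkl, smul_zero] at this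
    calc _ = H 0 k * H 0 l * ∑ j, H j k * H j l := by
          rw [Finset.mul_sum]; exact Finset.sum_congr rfl fun j _ => by simp only [hh]; ring
      _ = 0 := by rw [this, mul_zero]
  set f : ZMod p → ℝ := fun u => c * χ u with hf
  set A : Fin n → ZMod p → ℝ := fun k u => if u = 0 then -1 else b * h k (foldLabel hlab u) with hA
  have hfneg : ∀ x, f (-x) = -f x := fun x => by simp [hf, hχneg]
  have hAneg : ∀ k x, A k (-x) = A k x := fun k x => by simp [hA, foldLabel_neg]
  have hA0 : ∀ k, A k 0 = -1 := fun k => by simp [hA]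
  have hfA : ∀ k x, f x ^ 2 + A k x ^ 2 = 1 := fun k x => by
    by_cases hx : x = 0
    · simp [hf, hA, hx, hχ0]
    · simp only [hf, hA, hx, if_false, mul_pow, hχsq x hx, hhsq, hc, hb]
      field_simp; ring
  have hAA : ∀ k l, k ≠ l → ∑ x, A k x * A l x = 1 - 2 * b ^ 2 := fun k l hkl => by
    have hs := sum_foldLabel hpn hlab fun j => h k j * h l j
    simp only [hhorth k l hkl, hh0] at hs
    have : ∀ x, A k x * A l x = b ^ 2 * (h k (foldLabel hlab x) * h l (foldLabel hlab x)) +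
        if x = 0 then 1 - b ^ 2 else 0 := fun x => by
      by_cases hx : x = 0
      · simp [hA, hx, foldLabel_zero, hh0]
      · simp only [hA, hx, if_false]; ring
    simp only [this, Finset.sum_add_distrib, ← Finset.mul_sum, hs]
    simp; ring
  have hff : ∀ s t : ZMod p, ∑ x, f (x - s) * f (x - t) =
      c ^ 2 * ∑ x, χ x * χ (x + (s - t)) := fun s t => by
    rw [Finset.mul_sum, ← Equiv.sum_comp (Equiv.addRight s)]
    refine Finset.sum_congr rfl fun x _ => ?_
    simp only [hf, Equiv.coe_addRight, add_sub_cancel_right, add_sub_assoc]; ring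
  refine ⟨fun i => shiftedReflection f (A i.1) i.2, fun i => shiftedReflection_transpose
    (hAneg _) _, fun i => shiftedReflection_mul_self hfneg (hAneg _) (hfA _) _, ?_, ?_⟩
  · have : ∀ i : Fin n × ZMod p, trace (shiftedReflection f (A i.1) i.2) = ∑ x, f x - 1 := by
      rintro ⟨k, s⟩
      have hdiag : ∀ x : ZMod p, x = s + s - x ↔ x = s := fun x =>
        ⟨fun h => h2 _ _ (by linear_combination h), fun h => by rw [h]; ring⟩
      simp only [trace, diag_apply, shiftedReflection, of_apply, if_true, hdiag,
        Finset.sum_add_distrib, Finset.sum_ite_eq', Finset.mem_univ, sub_self, hA0]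
      rw [← (Equiv.subRight s).sum_comp f]
      simp [sub_eq_add_neg]
    intro i j
    rw [this, this]
  · rintro ⟨k, s⟩ ⟨l, t⟩ hij
    rw [trace_shiftedReflection_mul (hAneg _) h2, hff, hA0, hA0, ← neg_sub t s, hfneg]
    by_cases hst : s = t
    · subst hst
      have hkl : k ≠ l := fun hkl => hij (by rw [hkl])
      simp only [sub_self, neg_zero, add_zero, hχnorm, if_true, hAA k l hkl, hc, hb]
      field_simp; ring
    · rw [hχcorr _ (by rw [neg_sub]; exact sub_ne_zero.2 hst), if_neg hst, hc]
      ring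

theorem finrank_symMatrices_le (d : ℕ) : Module.finrank ℂ (symMatrices d) ≤ d * (d + 1) / 2 := by
  let L : symMatrices d →ₗ[ℂ] Sym2 (Fin d) → ℂ :=
    { toFun := fun A => Sym2.lift ⟨fun x y => A.1 x y, fun x y => congrFun (congrFun A.2 y) x⟩
      map_add' := fun A B => by
        ext z; induction z with | _ x y => rfl
      map_smul' := fun a A => by
        ext z; induction z with | _ x y => rfl }
  have hL : Function.Injective L := fun A B hAB => by
    ext x y
    exact congrFun hAB s(x, y)
  refine (LinearMap.finrank_le_finrank_of_injective hL).trans ?_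
  rw [Module.finrank_fintype_fun_eq_card, Sym2.card, Fintype.card_fin, Nat.choose_two_right,
    Nat.add_sub_cancel, mul_comm]

theorem linearIndependent_of_trace_orthogonal {ι m : Type*} [Fintype m]
    {U : ι → Matrix m m ℂ} (h0 : ∀ i, trace ((U i)ᴴ * U i) ≠ 0)
    (horth : ∀ i j, i ≠ j → trace ((U i)ᴴ * U j) = 0) : LinearIndependent ℂ U := by
  rw [linearIndependent_iff']
  intro s g hg i hi
  have := congrArg (fun A => trace ((U i)ᴴ * A)) hg
  simp only [Matrix.mul_sum, trace_sum, Matrix.mul_smul, trace_smul, Matrix.mul_zero,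
    trace_zero] at this
  rw [Finset.sum_eq_single i (fun j _ hj => by rw [horth i j hj.symm, smul_zero])
    (fun h => absurd hi h)] at this
  exact (mul_eq_zero.1 this).resolve_right (h0 i)

/-- In odd dimension, no unitary is trace-orthogonal to all symmetric matrices, since such a
unitary would be skew-symmetric. -/
theorem not_exists_unitary_orthogonal_symMatrices {d : ℕ} (hd : Odd d) {ι : Type*}
    {U : ι → Matrix (Fin d) (Fin d) ℂ} (hU : Submodule.span ℂ (Set.range U) = symMatrices d) :
    ¬ ∃ V : Matrix (Fin d) (Fin d) ℂ,
      V ∈ Matrix.unitaryGroup (Fin d) ℂ ∧ ∀ i, trace ((U i)ᴴ * V) = 0 := by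
  rintro ⟨V, hV, horth⟩
  have hsym : ∀ A ∈ symMatrices d, trace (Aᴴ * V) = 0 := by
    rw [← hU]
    intro A hA
    induction hA using Submodule.span_induction with
    | mem A hA => obtain ⟨i, rfl⟩ := hA; exact horth i
    | zero => simp
    | add A B _ _ hA hB => simp [add_mul, hA, hB]
    | smul a A _ hA => simp [hA]
  have hskew : Vᵀ = -V := by
    ext x y
    have := hsym (single x y 1 + single y x 1) (by
      change (_ : Matrix _ _ ℂ)ᵀ = _
      simp [add_comm])
    simp only [conjTranspose_add, conjTranspose_single, star_one, add_mul, trace_add,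
      trace_single_mul, smul_eq_mul, one_mul] at this
    simp only [transpose_apply, Matrix.neg_apply]
    linear_combination this
  have hdet : V.det = 0 := by
    have := congrArg det hskew
    rw [det_transpose, det_neg, Fintype.card_fin, hd.neg_one_pow] at this
    linear_combination this / 2
  have := congrArg det (mem_unitaryGroup_iff.1 hV)
  simp [hdet] at this

/-- The unitary `cos φ + i sin φ M` with `cos φ = 1 / (p + 1)`, for a real involution `M` of order
`p`. -/
noncomputable def rotatedInvolution {p : ℕ} (M : Matrix (Fin p) (Fin p) ℝ) :
    Matrix (Fin p) (Fin p) ℂ :=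
  (1 / (p + 1) : ℂ) • 1 + (Complex.I * (√(p * (p + 2)) / (p + 1) : ℝ)) • M.map Complex.ofRealHom

theorem conjTranspose_rotatedInvolution_mul {p : ℕ} {M N : Matrix (Fin p) (Fin p) ℝ}
    (hM : Mᵀ = M) :
    (rotatedInvolution M)ᴴ * rotatedInvolution N =
      ((1 / (p + 1)) ^ 2 : ℂ) • 1 + (p * (p + 2) / (p + 1) ^ 2 : ℂ) •
        (M * N).map Complex.ofRealHom +
      (1 / (p + 1) * (Complex.I * (√(p * (p + 2)) / (p + 1) : ℝ))) •
        (N.map Complex.ofRealHom - M.map Complex.ofRealHom) := by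
  have hMc : (M.map Complex.ofRealHom)ᴴ = M.map Complex.ofRealHom := by
    ext x y
    simpa using congrFun (congrFun hM x) y
  have hs : ((√(p * (p + 2)) / (p + 1) : ℝ) : ℂ) ^ 2 = p * (p + 2) / (p + 1) ^ 2 := by
    rw [← Complex.ofReal_pow, div_pow, Real.sq_sqrt (by positivity)]
    push_cast; rfl
  have hstar : star (1 / (p + 1) : ℂ) = 1 / (p + 1) := by simp
  rw [Matrix.map_mul, ← hs]
  unfold rotatedInvolution
  generalize (√(p * (p + 2)) / (p + 1) : ℝ) = σ
  simp only [conjTranspose_add, conjTranspose_smul, conjTranspose_one, hMc,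
    hstar, star_mul, Complex.star_def, Complex.conj_I, Complex.conj_ofReal, add_mul, mul_add,
    Matrix.smul_mul, Matrix.mul_smul, Matrix.one_mul, Matrix.mul_one]
  have hI := Complex.I_sq
  ext x y
  simp only [Matrix.add_apply, Matrix.smul_apply, Matrix.sub_apply, smul_eq_mul]
  linear_combination (-(σ : ℂ) ^ 2 * (M.map Complex.ofRealHom * N.map Complex.ofRealHom) x y) * hI

theorem exists_unitary_basis_symMatrices {p : ℕ} (hp : 0 < p)
    {M : Fin (p * (p + 1) / 2) → Matrix (Fin p) (Fin p) ℝ} (hsym : ∀ i, (M i)ᵀ = M i)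
    (hinv : ∀ i, M i * M i = 1) (htr : ∀ i j, trace (M i) = trace (M j))
    (htr2 : ∀ i j, i ≠ j → trace (M i * M j) = -1 / (p + 2)) :
    ∃ U : Fin (p * (p + 1) / 2) → Matrix (Fin p) (Fin p) ℂ,
      (∀ i, U i ∈ Matrix.unitaryGroup (Fin p) ℂ) ∧
      (∀ i j, i ≠ j → trace ((U i)ᴴ * U j) = 0) ∧
      Submodule.span ℂ (Set.range U) = symMatrices p := by
  have hp2 : (p : ℂ) + 2 ≠ 0 := by exact_mod_cast (p + 1).succ_ne_zero
  have hmap : ∀ A : Matrix (Fin p) (Fin p) ℝ, trace (A.map Complex.ofRealHom) = (trace A : ℝ) :=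
    fun A => by simp [trace]
  have hunit : ∀ i, (rotatedInvolution (M i))ᴴ * rotatedInvolution (M i) = 1 := fun i => by
    rw [conjTranspose_rotatedInvolution_mul (hsym i), hinv, sub_self, smul_zero, add_zero,
      Matrix.map_one _ (map_zero _) (map_one _), ← add_smul]
    convert one_smul ℂ _
    field_simp; ring
  have horth : ∀ i j, i ≠ j →
      trace ((rotatedInvolution (M i))ᴴ * rotatedInvolution (M j)) = 0 := fun i j hij => by
    rw [conjTranspose_rotatedInvolution_mul (hsym i)]
    simp only [trace_add, trace_sub, trace_smul, hmap, htr j i, htr2 i j hij, sub_self,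
      trace_one, Fintype.card_fin, smul_eq_mul]
    push_cast
    field_simp; ring
  refine ⟨fun i => rotatedInvolution (M i), fun i => mem_unitaryGroup_iff'.2 (hunit i), horth, ?_⟩
  refine Submodule.eq_of_le_of_finrank_le ?_ ?_
  · rw [Submodule.span_le]
    rintro _ ⟨i, rfl⟩
    change (rotatedInvolution (M i))ᵀ = _
    simp only [rotatedInvolution, transpose_add, transpose_smul, transpose_one, ← transpose_map,
      hsym]
  · rw [finrank_span_eq_card (linearIndependent_of_trace_orthogonal (fun i => ?_) horth)]
    · simpa using finrank_symMatrices_le p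
    · rw [hunit, trace_one, Fintype.card_fin]
      exact_mod_cast hp.ne'

/-- main theorem: for a prime p ≡ 7 (mod 8) admitting a Hadamard matrix
of order (p+1)/2, there exist N = p(p+1)/2 pairwise trace-orthogonal unitaries in
M_p(ℂ) spanning the symmetric subspace S_p, with no unitary trace-orthogonal to all of
them (i.e. a UMEB of cardinality p(p+1)/2 in ℂ^p ⊗ ℂ^p). -/
theorem UMEB_existence
    (p : ℕ) (hp : p.Prime) (hmod : p % 8 = 7)
    (hH : ∃ H : Matrix (Fin ((p + 1) / 2)) (Fin ((p + 1) / 2)) ℝ,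
      (∀ i j, H i j = 1 ∨ H i j = -1) ∧
      Hᵀ * H = (((p + 1) / 2 : ℕ) : ℝ) • (1 : Matrix (Fin ((p + 1) / 2)) (Fin ((p + 1) / 2)) ℝ)) :
    ∃ U : Fin (p * (p + 1) / 2) → Matrix (Fin p) (Fin p) ℂ,
      (∀ i, U i ∈ Matrix.unitaryGroup (Fin p) ℂ) ∧
      (∀ i j, i ≠ j → Matrix.trace ((U i)ᴴ * U j) = 0) ∧
      Submodule.span ℂ (Set.range U) = symMatrices p ∧
      ¬ ∃ V : Matrix (Fin p) (Fin p) ℂ,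
          V ∈ Matrix.unitaryGroup (Fin p) ℂ ∧ ∀ i, Matrix.trace ((U i)ᴴ * V) = 0 := by
  have : Fact p.Prime := ⟨hp⟩
  obtain ⟨H, hH1, hH⟩ := hH
  have hpn : p + 1 = 2 * ((p + 1) / 2) := by omega
  obtain ⟨M, hsym, hinv, htr, htr2⟩ :=
    exists_simplex_of_symmetric_involutions (p := p) (by omega) hpn hH1 hH
  let e : Fin p ≃ ZMod p := (ZMod.finEquiv p).toEquiv
  have hcard : Fintype.card (Fin (p * (p + 1) / 2)) =
      Fintype.card (Fin ((p + 1) / 2) × ZMod p) := by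
    rw [Fintype.card_prod, Fintype.card_fin, Fintype.card_fin, ZMod.card,
      Nat.mul_div_assoc _ ⟨_, hpn⟩, mul_comm]
  let E := Fintype.equivOfCardEq hcard
  have htrace : ∀ A : Matrix (ZMod p) (ZMod p) ℝ, trace (A.submatrix e e) = trace A := fun A => by
    simpa [trace] using e.sum_comp fun x => A x x
  obtain ⟨U, hU, horth, hspan⟩ := exists_unitary_basis_symMatrices hp.pos
    (M := fun i => (M (E i)).submatrix e e)
    (fun i => by rw [transpose_submatrix, hsym])
    (fun i => by rw [submatrix_mul_equiv, hinv, submatrix_one_equiv])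
    (fun i j => by rw [htrace, htrace, htr])
    (fun i j hij => by rw [submatrix_mul_equiv, htrace, htr2 _ _ (E.injective.ne hij)])
  exact ⟨U, hU, horth, hspan,
    not_exists_unitary_orthogonal_symMatrices (Nat.odd_iff.2 (by omega)) hspan⟩
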